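/- Let A ⊆ ℝ^d, let 0 < τ < r < reach A, let b ∈ A, and set A* := A ∩ closedBall(b, τ). Then for every a ∈ A*, dim Tan(A*, a) = dim Tan(A, a); in particular T_k(A*) = T_k(A) ∩ A* for all k. -/

import Mathlib

open Metric Set MeasureTheory
open scoped RealInnerProductSpace ENNReal NNReal

noncomputable section

abbrev Euc (d : ℕ) := EuclideanSpace ℝ (Fin d)

/-- Points of the ambient space having a unique nearest point in `A`. -/
def unp {d : ℕ} (A : Set (Euc d)) : Set (Euc d) :=
  {x | ∃! a, a ∈ A ∧ dist x a = Metric.infDist x A}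

/-- Federer's local reach `reach (A, a)`. -/
def reachAt {d : ℕ} (A : Set (Euc d)) (a : Euc d) : ℝ≥0∞ :=
  sSup {r : ℝ≥0∞ | ∀ x : Euc d, edist x a < r → x ∈ unp A}

/-- Federer's reach of a set. -/
def reach {d : ℕ} (A : Set (Euc d)) : ℝ≥0∞ := ⨅ a ∈ A, reachAt A a

/-- The tangent cone of `A` at `a`: `u` is a tangent vector iff `u = 0` or `u` is a limit of
`r i • (x i - a)` with `x i ∈ A \ {a}`, `x i → a`, `r i > 0`. -/
def tanCone {d : ℕ} (A : Set (Euc d)) (a : Euc d) : Set (Euc d) :=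
  {u | u = 0 ∨ ∃ (x : ℕ → Euc d) (r : ℕ → ℝ),
    (∀ n, x n ∈ A ∧ x n ≠ a) ∧
    Filter.Tendsto x Filter.atTop (nhds a) ∧
    (∀ n, 0 < r n) ∧
    Filter.Tendsto (fun n => r n • (x n - a)) Filter.atTop (nhds u)}

/-- The dimension of the tangent cone of `A` at `a`. -/
def tanDim {d : ℕ} (A : Set (Euc d)) (a : Euc d) : ℕ :=
  Module.finrank ℝ (Submodule.span ℝ (tanCone A a))

/-- The set of points of `A` at which the tangent cone has dimension `k`. -/
def Tk {d : ℕ} (A : Set (Euc d)) (k : ℕ) : Set (Euc d) :=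
  {x | x ∈ A ∧ tanDim A x = k}

/-- Whitney's fullness `Θ(σ) = vol_k(σ) / (diam σ)^k` of a set. -/
def fullness {d : ℕ} (k : ℕ) (s : Set (Euc d)) : ℝ :=
  (μH[(k : ℝ)] s).toReal / (Metric.diam s) ^ k

/-- The metric `ρ_k` on the Grassmannian of subspaces of `ℝ^d`. -/
def grassDist {d : ℕ} (U V : Submodule ℝ (Euc d)) : ℝ :=
  max (sSup ((fun u => Metric.infDist u (V : Set (Euc d))) '' {u | u ∈ U ∧ ‖u‖ = 1}))
      (sSup ((fun v => Metric.infDist v (U : Set (Euc d))) '' {v | v ∈ V ∧ ‖v‖ = 1}))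

/-- Points at distance less than the reach of `A` have a unique nearest point in `A`. -/
theorem mem_unp_of_infDist_lt {d : ℕ} {A : Set (Euc d)} {r : ℝ} (hne : A.Nonempty)
    (hr : ENNReal.ofReal r < reach A) {x : Euc d} (hx : infDist x A < r) : x ∈ unp A := by
  obtain ⟨a, ha, hxa⟩ := (infDist_lt_iff hne).1 hx
  have h1 : ENNReal.ofReal r < reachAt A a := hr.trans_le (iInf₂_le a ha)
  obtain ⟨s, hs, hrs⟩ := lt_sSup_iff.1 h1
  refine hs x (lt_of_le_of_lt ?_ hrs)
  rw [edist_dist]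
  exact ENNReal.ofReal_le_ofReal hxa.le

theorem isClosed_of_forall_mem_unp {d : ℕ} {A : Set (Euc d)} {R : ℝ} (hR : 0 < R)
    (hU : ∀ x, infDist x A < R → x ∈ unp A) : IsClosed A := by
  refine isClosed_of_closure_subset fun x hx => ?_
  have h0 : infDist x A = 0 := infDist_zero_of_mem_closure hx
  obtain ⟨a, ⟨ha, hxa⟩, -⟩ := hU x (by rw [h0]; exact hR)
  rw [h0, dist_eq_zero] at hxa
  rwa [hxa]

/-- Away from `A`, but inside the neighbourhood of unique nearest points, the distance function
to `A` has upper slope one. -/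
theorem exists_infDist_add_mul_lt {d : ℕ} {A : Set (Euc d)} {R : ℝ} (hcl : IsClosed A)
    (hU : ∀ x, infDist x A < R → x ∈ unp A) {y : Euc d} (hy0 : 0 < infDist y A)
    (hyR : infDist y A < R) {c η : ℝ} (hc0 : 0 < c) (hc1 : c < 1) (hη : 0 < η) :
    ∃ z, dist z y < η ∧ infDist y A + c * dist z y < infDist z A := by
  obtain ⟨p, ⟨hp, hyp⟩, huniq⟩ := hU y hyR
  have hne : A.Nonempty := ⟨p, hp⟩
  set δ := infDist y A with hδ
  set B : Set (Euc d) := A ∩ {q | ⟪y - p, y - q⟫ ≤ c * δ ^ 2} with hB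
  have hBcl : IsClosed B := hcl.inter (isClosed_le (by fun_prop) (by fun_prop))
  have hnp : ‖y - p‖ = δ := by rw [← dist_eq_norm]; exact hyp
  have hpB : p ∉ B := by
    rintro ⟨-, h⟩
    simp only [mem_ofPred_eq, real_inner_self_eq_norm_sq, hnp] at h
    nlinarith [pow_pos hy0 2]
  have hm : ∃ m, δ < m ∧ ∀ q ∈ B, m ≤ dist y q := by
    rcases B.eq_empty_or_nonempty with h | h
    · exact ⟨δ + 1, by linarith, by simp [h]⟩
    · obtain ⟨q, hq, hqe⟩ := hBcl.exists_infDist_eq_dist h y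
      refine ⟨dist y q, ?_, fun q' hq' => hqe ▸ infDist_le_dist_of_mem hq'⟩
      refine lt_of_le_of_ne (infDist_le_dist_of_mem hq.1) fun h' => hpB ?_
      rwa [← huniq q ⟨hq.1, h'.symm⟩]
  obtain ⟨m, hδm, hm⟩ := hm
  obtain ⟨s, hs0, hs⟩ : ∃ s, 0 < s ∧ s < min (min η (R - δ)) ((m - δ) / 2) :=
    exists_between (lt_min (lt_min hη (by linarith)) (by linarith))
  simp only [lt_min_iff] at hs
  obtain ⟨⟨hsη, hsR⟩, hsm⟩ := hs
  set z := y + (s / δ) • (y - p) with hz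
  have hzy : dist z y = s := by
    rw [dist_eq_norm, hz, add_sub_cancel_left, norm_smul, hnp, Real.norm_of_nonneg (by positivity)]
    field_simp
  have hzle : infDist z A ≤ δ + s := by
    rw [← hzy]; exact infDist_le_infDist_add_dist
  obtain ⟨q, ⟨hq, hzq⟩, -⟩ := hU z (by linarith)
  have hyq : dist y q < m := by
    have := dist_triangle y z q
    rw [dist_comm y z] at this
    linarith
  have hqB : q ∉ B := fun h => absurd (hm q h) (not_le.2 hyq)
  have hin : c * δ ^ 2 < ⟪y - p, y - q⟫ := by
    by_contra h
    exact hqB ⟨hq, not_lt.1 h⟩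
  have hδq : δ ≤ ‖y - q‖ := by rw [← dist_eq_norm]; exact infDist_le_dist_of_mem hq
  refine ⟨z, by rw [hzy]; exact hsη, ?_⟩
  rw [hzy, ← hzq, dist_eq_norm]
  have hexp : ‖z - q‖ ^ 2 = ‖y - q‖ ^ 2 + 2 * (s / δ) * ⟪y - p, y - q⟫ + s ^ 2 := by
    have : z - q = (y - q) + (s / δ) • (y - p) := by rw [hz]; abel
    rw [this, norm_add_sq_real, norm_smul, hnp, Real.norm_of_nonneg (by positivity),
      real_inner_smul_right, real_inner_comm]
    field_simp
  have h1 : s * c * δ < (s / δ) * ⟪y - p, y - q⟫ := by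
    have : s * c * δ = (s / δ) * (c * δ ^ 2) := by field_simp
    rw [this]
    exact mul_lt_mul_of_pos_left hin (by positivity)
  refine lt_of_pow_lt_pow_left₀ 2 (norm_nonneg _) ?_
  rw [hexp]
  have h2 : c ^ 2 < 1 := by nlinarith
  nlinarith [pow_pos hs0 2, pow_le_pow_left₀ hy0.le hδq 2]

/-- Normal segments extend: from a point off `A` one can move away from `A` at unit speed. -/
theorem exists_dist_le_infDist_add_le {d : ℕ} {A : Set (Euc d)} {R : ℝ} (hcl : IsClosed A)
    (hU : ∀ x, infDist x A < R → x ∈ unp A) {x : Euc d} (hx0 : 0 < infDist x A)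
    {T : ℝ} (hT : 0 < T) (hTR : infDist x A + T < R) :
    ∃ y, dist y x ≤ T ∧ infDist x A + T ≤ infDist y A := by
  have hcomp : IsCompact (closedBall x T) := isCompact_closedBall x T
  have hnon : (closedBall x T).Nonempty := ⟨x, mem_closedBall_self hT.le⟩
  obtain ⟨w, hw, hwmax⟩ := hcomp.exists_isMaxOn hnon (continuous_infDist_pt A).continuousOn
  refine ⟨w, hw, ?_⟩
  have key : ∀ c ∈ Ioo (0 : ℝ) 1, infDist x A + c * T ≤ infDist w A := by
    rintro c ⟨hc0, hc1⟩
    obtain ⟨y, hy, hymax⟩ := hcomp.exists_isMaxOn hnon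
      (f := fun y => infDist y A - c * dist y x)
      ((continuous_infDist_pt A).sub (by fun_prop)).continuousOn
    have hyx : infDist x A + c * dist y x ≤ infDist y A := by
      have := hymax (mem_closedBall_self hT.le)
      simp only [mem_ofPred_eq, dist_self, mul_zero, sub_zero] at this
      linarith
    have hyw : infDist y A ≤ infDist w A := hwmax hy
    rcases (mem_closedBall.1 hy).lt_or_eq with hlt | heq
    · exfalso
      have h1 : infDist y A ≤ infDist x A + dist y x := infDist_le_infDist_add_dist
      have h2 : 0 ≤ c * dist y x := by positivity
      obtain ⟨z, hz, hzlt⟩ := exists_infDist_add_mul_lt hcl hU (y := y) (by linarith)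
        (by linarith) hc0 hc1 (sub_pos.2 hlt)
      have htri := dist_triangle z y x
      have := hymax (show z ∈ closedBall x T by rw [mem_closedBall]; linarith)
      simp only [mem_ofPred_eq] at this
      nlinarith
    · rw [heq] at hyx
      linarith
  have hclosed : IsClosed {c : ℝ | infDist x A + c * T ≤ infDist w A} :=
    isClosed_le (by fun_prop) (by fun_prop)
  have h1 : (1 : ℝ) ∈ closure (Ioo (0 : ℝ) 1) := by
    rw [closure_Ioo zero_ne_one]; simp
  simpa using hclosed.closure_subset_iff.2 key h1

/-- Federer's inequality for proximal normals of a set of positive reach. -/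
theorem inner_sub_nearest_le {d : ℕ} {A : Set (Euc d)} {R : ℝ} (hcl : IsClosed A)
    (hU : ∀ x, infDist x A < R → x ∈ unp A) {x a c : Euc d} (ha : a ∈ A) (hc : c ∈ A)
    (hxa : dist x a = infDist x A) (hxR : infDist x A < R) :
    2 * R * ⟪x - a, c - a⟫ ≤ ‖x - a‖ * ‖c - a‖ ^ 2 := by
  rcases (infDist_nonneg (x := x) (s := A)).eq_or_lt with h0 | h0
  · rw [← h0, dist_eq_zero] at hxa
    simp [hxa]
  set D := infDist x A with hD
  have hn : ‖x - a‖ = D := by rw [← dist_eq_norm, hxa]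
  have key : ∀ S ∈ Ioo D R, 2 * S * ⟪x - a, c - a⟫ ≤ ‖x - a‖ * ‖c - a‖ ^ 2 := by
    rintro S ⟨hS1, hS2⟩
    obtain ⟨y, hyx, hy⟩ := exists_dist_le_infDist_add_le hcl hU (x := x) h0
      (T := S - D) (by linarith) (by linarith)
    have hya : infDist y A ≤ ‖y - a‖ := by
      rw [← dist_eq_norm]; exact infDist_le_dist_of_mem ha
    have hyc : infDist y A ≤ ‖y - c‖ := by
      rw [← dist_eq_norm]; exact infDist_le_dist_of_mem hc
    rw [dist_eq_norm] at hyx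
    have hsum : (x - a) + (y - x) = y - a := by abel
    have htri : ‖y - a‖ ≤ ‖x - a‖ + ‖y - x‖ := hsum ▸ norm_add_le _ _
    have hyx' : ‖y - x‖ = S - D := by linarith
    have hya' : ‖y - a‖ = S := by linarith
    have hray : SameRay ℝ (x - a) (y - x) :=
      sameRay_iff_norm_add.2 (by rw [hsum]; linarith)
    have hray' := hray.norm_smul_eq
    rw [hn, hyx'] at hray'
    have hDy : D • (y - a) = S • (x - a) := by
      rw [← hsum, smul_add, hray', sub_smul]; abel
    have hin : D * ⟪y - a, c - a⟫ = S * ⟪x - a, c - a⟫ := by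
      rw [← real_inner_smul_left, hDy, real_inner_smul_left]
    have hexp : ‖y - c‖ ^ 2 = ‖y - a‖ ^ 2 - 2 * ⟪y - a, c - a⟫ + ‖c - a‖ ^ 2 := by
      rw [← norm_sub_sq_real]; congr 2; abel
    have hsq : S ^ 2 ≤ ‖y - c‖ ^ 2 := pow_le_pow_left₀ (by linarith) (by linarith) 2
    rw [hn]
    rw [hexp, hya'] at hsq
    nlinarith
  have hclosed : IsClosed {S : ℝ | 2 * S * ⟪x - a, c - a⟫ ≤ ‖x - a‖ * ‖c - a‖ ^ 2} :=
    isClosed_le (by fun_prop) (by fun_prop)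
  have h1 : R ∈ closure (Ioo D R) := by
    rw [closure_Ioo hxR.ne]; exact ⟨hxR.le, le_rfl⟩
  exact hclosed.closure_subset_iff.2 key h1

/-- Segments between nearby points of a set of positive reach stay close to the set. -/
theorem infDist_segment_le {d : ℕ} {A : Set (Euc d)} {R : ℝ} (hR : 0 < R)
    (hU : ∀ x, infDist x A < R → x ∈ unp A) {a b : Euc d} (ha : a ∈ A) (hb : b ∈ A)
    (hab : ‖b - a‖ < R) {t : ℝ} (ht0 : 0 ≤ t) (ht1 : t ≤ 1) :
    R * infDist (a + t • (b - a)) A ≤ t * ‖b - a‖ ^ 2 := by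
  have hcl := isClosed_of_forall_mem_unp hR hU
  set x := a + t • (b - a) with hx
  set D := infDist x A with hD
  have hDle : D ≤ t * ‖b - a‖ := by
    refine (infDist_le_dist_of_mem ha).trans_eq ?_
    rw [dist_eq_norm, hx, add_sub_cancel_left, norm_smul, Real.norm_of_nonneg ht0]
  have hDR : D < R := by nlinarith [norm_nonneg (b - a)]
  have hD0 : 0 ≤ D := infDist_nonneg
  obtain ⟨q, ⟨hq, hxq⟩, -⟩ := hU x hDR
  have hn : ‖x - q‖ = D := by rw [← dist_eq_norm, hxq]
  have h1 := inner_sub_nearest_le hcl hU hq ha hxq hDR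
  have h2 := inner_sub_nearest_le hcl hU hq hb hxq hDR
  have hcomb : x - q = (1 - t) • (a - q) + t • (b - q) := by rw [hx]; module
  have hin : D ^ 2 = (1 - t) * ⟪x - q, a - q⟫ + t * ⟪x - q, b - q⟫ := by
    rw [← hn, ← real_inner_self_eq_norm_sq, ← real_inner_smul_right, ← real_inner_smul_right,
      ← inner_add_right, ← hcomb]
  have hsq : D ^ 2 = (1 - t) * ‖a - q‖ ^ 2 + t * ‖b - q‖ ^ 2 - t * (1 - t) * ‖b - a‖ ^ 2 := by
    have hba : b - a = (b - q) - (a - q) := by abel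
    rw [← hn, hcomb, hba, norm_add_sq_real, norm_sub_sq_real (b - q) (a - q), norm_smul, norm_smul,
      real_inner_smul_left, real_inner_smul_right, mul_pow, mul_pow, Real.norm_eq_abs,
      Real.norm_eq_abs, sq_abs, sq_abs, real_inner_comm (b - q) (a - q)]
    ring
  rw [hn] at h1 h2
  rcases hD0.eq_or_lt with h0 | h0
  · rw [← h0, mul_zero]; positivity
  have h3 : D * (2 * R * D) ≤ D * (D ^ 2 + t * (1 - t) * ‖b - a‖ ^ 2) := by
    have e1 := mul_le_mul_of_nonneg_left h1 (sub_nonneg.2 ht1)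
    have e2 := mul_le_mul_of_nonneg_left h2 ht0
    have e3 : D ^ 2 + t * (1 - t) * ‖b - a‖ ^ 2 = (1 - t) * ‖a - q‖ ^ 2 + t * ‖b - q‖ ^ 2 := by
      rw [hsq]; ring
    rw [e3]
    have e4 : D * (2 * R * D) = 2 * R * D ^ 2 := by ring
    rw [e4, hin]
    linarith
  have h4 := le_of_mul_le_mul_left h3 h0
  have h5 : t * (1 - t) * ‖b - a‖ ^ 2 ≤ t * ‖b - a‖ ^ 2 := by
    have : 0 ≤ t * t * ‖b - a‖ ^ 2 := by positivity
    nlinarith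
  nlinarith

/-- Rays in tangent directions of a set of positive reach are tangent to the set to first order. -/
theorem infDist_ray_le_of_mem_tanCone {d : ℕ} {A : Set (Euc d)} {R : ℝ} (hR : 0 < R)
    (hU : ∀ x, infDist x A < R → x ∈ unp A) {a u : Euc d} (ha : a ∈ A)
    (hu : u ∈ tanCone A a) {ε : ℝ} (hε : 0 < ε) :
    ∃ t₀ > 0, ∀ t, 0 ≤ t → t ≤ t₀ → infDist (a + t • u) A ≤ ε * t := by
  rcases hu with rfl | ⟨x, r, hx, hxa, hr, hlim⟩
  · refine ⟨1, one_pos, fun t ht _ => ?_⟩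
    rw [smul_zero, add_zero, infDist_zero_of_mem ha]
    positivity
  have hsub : Filter.Tendsto (fun n => ‖x n - a‖) Filter.atTop (nhds 0) := by
    simpa using (hxa.sub_const a).norm
  have hquad : Filter.Tendsto (fun n => ‖r n • (x n - a)‖ * ‖x n - a‖) Filter.atTop (nhds 0) := by
    simpa using hlim.norm.mul hsub
  have hdiff : Filter.Tendsto (fun n => ‖r n • (x n - a) - u‖) Filter.atTop (nhds 0) := by
    simpa using (hlim.sub_const u).norm
  obtain ⟨n, h1, h2, h3⟩ := ((hsub.eventually (gt_mem_nhds hR)).and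
    ((hquad.eventually (gt_mem_nhds (show 0 < R * (ε / 2) by positivity))).and
      (hdiff.eventually (gt_mem_nhds (half_pos hε))))).exists
  refine ⟨(r n)⁻¹, inv_pos.2 (hr n), fun t ht0 ht => ?_⟩
  have htr : t * r n ≤ 1 := by
    calc t * r n ≤ (r n)⁻¹ * r n := mul_le_mul_of_nonneg_right ht (hr n).le
      _ = 1 := inv_mul_cancel₀ (hr n).ne'
  have hseg := infDist_segment_le hR hU ha (hx n).1 h1 (mul_nonneg ht0 (hr n).le) htr
  have hA1 : infDist (a + (t * r n) • (x n - a)) A ≤ ε / 2 * t := by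
    rw [norm_smul, Real.norm_of_nonneg (hr n).le] at h2
    refine le_of_mul_le_mul_left (hseg.trans ?_) hR
    have := mul_le_mul_of_nonneg_left h2.le ht0
    nlinarith
  have hd : dist (a + t • u) (a + (t * r n) • (x n - a)) ≤ ε / 2 * t := by
    rw [dist_comm, dist_eq_norm, add_sub_add_left_eq_sub, mul_smul, ← smul_sub, norm_smul,
      Real.norm_of_nonneg ht0, mul_comm]
    exact mul_le_mul_of_nonneg_right h3.le ht0
  have := infDist_le_infDist_add_dist (s := A) (x := a + t • u)
    (y := a + (t * r n) • (x n - a))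
  linarith

theorem mem_tanCone_of_infDist_ray_le {d : ℕ} {A : Set (Euc d)} {a u : Euc d} (ha : a ∈ A)
    (h : ∀ ε > 0, ∃ t₀ > 0, ∀ t, 0 ≤ t → t ≤ t₀ → infDist (a + t • u) A ≤ ε * t) :
    u ∈ tanCone A a := by
  rcases eq_or_ne u 0 with rfl | hu
  · exact Or.inl rfl
  have hstep : ∀ n : ℕ, ∃ t : ℝ, ∃ p ∈ A, 0 < t ∧ t ≤ 1 / ((n : ℝ) + 1) ∧
      ‖t⁻¹ • (p - a) - u‖ < min (1 / ((n : ℝ) + 1)) ‖u‖ := by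
    intro n
    have hε : 0 < min (1 / ((n : ℝ) + 1)) ‖u‖ := lt_min (by positivity) (norm_pos_iff.2 hu)
    obtain ⟨t₀, ht₀, ht⟩ := h _ (half_pos hε)
    set ε := min (1 / ((n : ℝ) + 1)) ‖u‖
    have htpos : 0 < min t₀ (1 / ((n : ℝ) + 1)) := lt_min ht₀ (by positivity)
    have h1 := ht _ htpos.le (min_le_left _ _)
    set t := min t₀ (1 / ((n : ℝ) + 1))
    have h2 : infDist (a + t • u) A < ε * t := by nlinarith [mul_pos hε htpos]
    obtain ⟨p, hp, hpd⟩ := (infDist_lt_iff ⟨a, ha⟩).1 h2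
    refine ⟨t, p, hp, htpos, min_le_right _ _, ?_⟩
    have heq : t⁻¹ • (p - a) - u = t⁻¹ • (p - (a + t • u)) := by
      rw [← sub_sub, smul_sub _ (p - a), inv_smul_smul₀ htpos.ne']
    rw [heq, norm_smul, Real.norm_of_nonneg (by positivity), ← dist_eq_norm, dist_comm,
      inv_mul_lt_iff₀ htpos, mul_comm]
    exact hpd
  choose t p hp ht0 ht1 hlt using hstep
  have hlim : Filter.Tendsto (fun n => (t n)⁻¹ • (p n - a)) Filter.atTop (nhds u) := by
    rw [tendsto_iff_norm_sub_tendsto_zero]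
    exact squeeze_zero (fun _ => norm_nonneg _) (fun n => (hlt n).le.trans (min_le_left _ _))
      tendsto_one_div_add_atTop_nhds_zero_nat
  have htlim : Filter.Tendsto t Filter.atTop (nhds 0) :=
    squeeze_zero (fun n => (ht0 n).le) ht1 tendsto_one_div_add_atTop_nhds_zero_nat
  refine Or.inr ⟨p, fun n => (t n)⁻¹, fun n => ⟨hp n, fun hpa => ?_⟩, ?_,
    fun n => inv_pos.2 (ht0 n), hlim⟩
  · have := (hlt n).trans_le (min_le_right _ _)
    simp [hpa] at this
  · have := (htlim.smul hlim).add_const a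
    simpa [smul_smul, mul_inv_cancel₀ (ht0 _).ne'] using this

theorem smul_mem_tanCone {d : ℕ} {A : Set (Euc d)} {a u : Euc d} (hu : u ∈ tanCone A a)
    {c : ℝ} (hc : 0 < c) : c • u ∈ tanCone A a := by
  rcases hu with rfl | ⟨x, r, hx, hxa, hr, hlim⟩
  · exact Or.inl (smul_zero c)
  · refine Or.inr ⟨x, fun n => c * r n, hx, hxa, fun n => mul_pos hc (hr n), ?_⟩
    simpa only [mul_smul] using hlim.const_smul c

/-- The tangent cone of a set of positive reach is closed under addition. -/
theorem add_mem_tanCone {d : ℕ} {A : Set (Euc d)} {R : ℝ} (hR : 0 < R)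
    (hU : ∀ x, infDist x A < R → x ∈ unp A) {a u v : Euc d} (ha : a ∈ A)
    (hu : u ∈ tanCone A a) (hv : v ∈ tanCone A a) : u + v ∈ tanCone A a := by
  suffices h : (2⁻¹ : ℝ) • (u + v) ∈ tanCone A a by
    simpa using smul_mem_tanCone h (two_pos (α := ℝ))
  refine mem_tanCone_of_infDist_ray_le ha fun ε hε => ?_
  obtain ⟨t₁, ht₁, h₁⟩ := infDist_ray_le_of_mem_tanCone hR hU ha hu (half_pos (half_pos hε))
  obtain ⟨t₂, ht₂, h₂⟩ := infDist_ray_le_of_mem_tanCone hR hU ha hv (half_pos (half_pos hε))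
  set C := ‖v - u‖ + ε with hC
  have hCpos : 0 < C := by positivity
  refine ⟨min (min t₁ t₂) (min (R / (2 * C)) (R * ε / C ^ 2)), by positivity,
    fun t ht0 ht => ?_⟩
  simp only [le_min_iff] at ht
  obtain ⟨⟨ht1, ht2⟩, ht3, ht4⟩ := ht
  rcases ht0.eq_or_lt with rfl | htpos
  · simp [infDist_zero_of_mem ha]
  rw [le_div_iff₀ (by positivity)] at ht3 ht4
  have hεt : ε / 2 / 2 * t < ε / 2 * t := by nlinarith
  obtain ⟨p, hp, hpd⟩ := (infDist_lt_iff ⟨a, ha⟩).1 ((h₁ t ht0 ht1).trans_lt hεt)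
  obtain ⟨q, hq, hqd⟩ := (infDist_lt_iff ⟨a, ha⟩).1 ((h₂ t ht0 ht2).trans_lt hεt)
  rw [dist_comm, dist_eq_norm] at hpd hqd
  have hpq : ‖q - p‖ ≤ C * t := by
    have : q - p = (q - (a + t • v)) - (p - (a + t • u)) + t • (v - u) := by module
    rw [this]
    refine (norm_add_le _ _).trans ?_
    rw [norm_smul, Real.norm_of_nonneg ht0, hC]
    have := norm_sub_le (q - (a + t • v)) (p - (a + t • u))
    linarith
  have hpqR : ‖q - p‖ < R := by nlinarith
  have hseg := infDist_segment_le hR hU hp hq hpqR (t := 2⁻¹) (by norm_num) (by norm_num)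
  have hm : infDist (p + (2⁻¹ : ℝ) • (q - p)) A ≤ ε / 2 * t := by
    refine le_of_mul_le_mul_left (hseg.trans ?_) hR
    have := pow_le_pow_left₀ (norm_nonneg _) hpq 2
    nlinarith
  have hd : dist (a + t • (2⁻¹ : ℝ) • (u + v)) (p + (2⁻¹ : ℝ) • (q - p)) ≤ ε / 2 * t := by
    have : p + (2⁻¹ : ℝ) • (q - p) - (a + t • (2⁻¹ : ℝ) • (u + v)) =
        (2⁻¹ : ℝ) • ((p - (a + t • u)) + (q - (a + t • v))) := by module
    rw [dist_comm, dist_eq_norm, this, norm_smul, Real.norm_of_nonneg (by norm_num)]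
    have := norm_add_le (p - (a + t • u)) (q - (a + t • v))
    linarith
  have := infDist_le_infDist_add_dist (s := A) (x := a + t • (2⁻¹ : ℝ) • (u + v))
    (y := p + (2⁻¹ : ℝ) • (q - p))
  linarith

/-- A set of positive reach has, at each of its points, a tangent vector making an acute angle
with the direction to any other sufficiently close point of the set. -/
theorem exists_mem_tanCone_inner_pos {d : ℕ} {A : Set (Euc d)} {R : ℝ} (hR : 0 < R)
    (hU : ∀ x, infDist x A < R → x ∈ unp A) {a b : Euc d} (ha : a ∈ A) (hb : b ∈ A)
    (hab : a ≠ b) (habR : ‖b - a‖ < R) : ∃ v ∈ tanCone A a, 0 < ⟪v, b - a⟫ := by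
  have hcl := isClosed_of_forall_mem_unp hR hU
  set L := ‖b - a‖ with hL
  have hLpos : 0 < L := norm_pos_iff.2 (sub_ne_zero.2 hab.symm)
  set t : ℕ → ℝ := fun n => 1 / ((n : ℝ) + 1) with ht
  have ht0 : ∀ n, 0 < t n := fun n => by positivity
  have ht1 : ∀ n, t n ≤ 1 := fun n => by
    rw [ht]; exact (div_le_one (by positivity)).2 (by linarith [n.cast_nonneg (α := ℝ)])
  have htlim : Filter.Tendsto t Filter.atTop (nhds 0) := tendsto_one_div_add_atTop_nhds_zero_nat
  choose q hq hqd using fun n => hcl.exists_infDist_eq_dist ⟨a, ha⟩ (a + t n • (b - a))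
  have hdist : ∀ n, ‖(t n)⁻¹ • (q n - a) - (b - a)‖ ≤ L ^ 2 / R := by
    intro n
    have hseg := infDist_segment_le hR hU ha hb habR (ht0 n).le (ht1 n)
    have heq : (t n)⁻¹ • (q n - a) - (b - a) = (t n)⁻¹ • (q n - (a + t n • (b - a))) := by
      rw [← sub_sub, smul_sub _ (q n - a), inv_smul_smul₀ (ht0 n).ne']
    rw [heq, norm_smul, Real.norm_of_nonneg (inv_pos.2 (ht0 n)).le, ← dist_eq_norm, dist_comm,
      ← hqd, inv_mul_le_iff₀ (ht0 n), ← mul_div_assoc, le_div_iff₀ hR, mul_comm]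
    exact hseg
  obtain ⟨v, hv, φ, hφ, hlim⟩ := tendsto_subseq_of_bounded
    (isBounded_closedBall (x := b - a) (r := L ^ 2 / R))
    (x := fun n => (t n)⁻¹ • (q n - a)) fun n => by
      rw [mem_closedBall, dist_eq_norm]; exact hdist n
  rw [isClosed_closedBall.closure_eq, mem_closedBall, dist_eq_norm] at hv
  have hpos : ∀ w : Euc d, ‖w - (b - a)‖ ≤ L ^ 2 / R → 0 < ⟪w, b - a⟫ := by
    intro w hw
    have h1 : ⟪w, b - a⟫ = L ^ 2 + ⟪w - (b - a), b - a⟫ := by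
      rw [inner_sub_left, real_inner_self_eq_norm_sq]; ring
    have h2 := neg_le_of_abs_le (abs_real_inner_le_norm (w - (b - a)) (b - a))
    have h3 : L ^ 2 / R * L < L ^ 2 := by
      rw [div_mul_eq_mul_div, div_lt_iff₀ hR]
      exact mul_lt_mul_of_pos_left habR (by positivity)
    have h4 := mul_le_mul_of_nonneg_right hw hLpos.le
    linarith
  refine ⟨v, Or.inr ⟨q ∘ φ, fun n => (t (φ n))⁻¹, fun n => ⟨hq _, fun h => ?_⟩, ?_,
    fun n => inv_pos.2 (ht0 _), hlim⟩, hpos v hv⟩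
  · have := hpos _ (hdist (φ n))
    rw [Function.comp_apply] at h
    simp [h] at this
  · have := ((htlim.comp hφ.tendsto_atTop).smul hlim).add_const a
    simpa [Function.comp_def, smul_smul, mul_inv_cancel₀ (ht0 _).ne'] using this

theorem tanCone_mono {d : ℕ} {A B : Set (Euc d)} (h : A ⊆ B) (a : Euc d) :
    tanCone A a ⊆ tanCone B a := by
  rintro u (hu | ⟨x, r, hx, hrest⟩)
  · exact Or.inl hu
  · exact Or.inr ⟨x, r, fun n => ⟨h (hx n).1, (hx n).2⟩, hrest⟩

/-- Tangent vectors at a point of a closed ball that point into the ball are tangent to the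
intersection with the ball. -/
theorem mem_tanCone_inter_closedBall {d : ℕ} {A : Set (Euc d)} {a b u : Euc d} {τ : ℝ}
    (hab : a ∈ closedBall b τ) (hu : u ∈ tanCone A a)
    (h : dist a b < τ ∨ 0 < ⟪u, b - a⟫) : u ∈ tanCone (A ∩ closedBall b τ) a := by
  rcases hu with hu | ⟨x, r, hx, hxa, hr, hlim⟩
  · exact Or.inl hu
  have hev : ∀ᶠ n in Filter.atTop, x n ∈ closedBall b τ := by
    rcases h with h | h
    · exact hxa.eventually (closedBall_mem_nhds_of_mem h)
    · have hsub : Filter.Tendsto (fun n => x n - a) Filter.atTop (nhds 0) := by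
        simpa using hxa.sub_const a
      have hlim2 : Filter.Tendsto
          (fun n => 2 * ⟪r n • (x n - a), b - a⟫ - ⟪r n • (x n - a), x n - a⟫)
          Filter.atTop (nhds (2 * ⟪u, b - a⟫ - ⟪u, 0⟫)) :=
        ((hlim.inner tendsto_const_nhds).const_mul 2).sub (hlim.inner hsub)
      rw [inner_zero_right, sub_zero] at hlim2
      filter_upwards [hlim2.eventually (lt_mem_nhds (show 0 < 2 * ⟪u, b - a⟫ by linarith))]
        with n hn
      rw [real_inner_smul_left, real_inner_smul_left, real_inner_self_eq_norm_sq] at hn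
      have h1 : 0 < 2 * ⟪x n - a, b - a⟫ - ‖x n - a‖ ^ 2 := by
        refine (mul_pos_iff_of_pos_left (hr n)).1 ?_
        linarith
      have h2 : ‖x n - b‖ ^ 2 = ‖x n - a‖ ^ 2 - 2 * ⟪x n - a, b - a⟫ + ‖b - a‖ ^ 2 := by
        rw [← norm_sub_sq_real]; congr 2; abel
      rw [mem_closedBall, dist_eq_norm] at hab ⊢
      rw [norm_sub_rev] at hab
      refine le_trans ?_ hab
      exact (pow_le_pow_iff_left₀ (norm_nonneg _) (norm_nonneg _) two_ne_zero).1 (by linarith)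
  obtain ⟨N, hN⟩ := Filter.eventually_atTop.1 hev
  exact Or.inr ⟨fun n => x (n + N), fun n => r (n + N),
    fun n => ⟨⟨(hx _).1, hN _ (Nat.le_add_left N n)⟩, (hx _).2⟩,
    hxa.comp (Filter.tendsto_add_atTop_nat N), fun n => hr _,
    hlim.comp (Filter.tendsto_add_atTop_nat N)⟩

theorem span_tanCone_inter_closedBall {d : ℕ} {A : Set (Euc d)} {τ R : ℝ} (hτ : 0 < τ)
    (hτR : τ < R) (hU : ∀ x, infDist x A < R → x ∈ unp A) {a b : Euc d} (ha : a ∈ A)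
    (hb : b ∈ A) (hab : a ∈ closedBall b τ) :
    Submodule.span ℝ (tanCone (A ∩ closedBall b τ) a) = Submodule.span ℝ (tanCone A a) := by
  refine le_antisymm (Submodule.span_mono (tanCone_mono inter_subset_left a)) ?_
  rw [Submodule.span_le]
  intro u hu
  rcases (mem_closedBall.1 hab).lt_or_eq with hlt | heq
  · exact Submodule.subset_span (mem_tanCone_inter_closedBall hab hu (Or.inl hlt))
  have hR : 0 < R := hτ.trans hτR
  have hne : a ≠ b := dist_pos.1 (by rw [heq]; exact hτ)
  obtain ⟨v, hv, hvpos⟩ := exists_mem_tanCone_inner_pos hR hU ha hb hne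
    (by rw [← dist_eq_norm, dist_comm, heq]; exact hτR)
  set ε := ⟪v, b - a⟫ / (|⟪u, b - a⟫| + 1) with hε
  have hεpos : 0 < ε := by positivity
  have hw : v + ε • u ∈ tanCone A a := add_mem_tanCone hR hU ha hv (smul_mem_tanCone hu hεpos)
  have hwpos : 0 < ⟪v + ε • u, b - a⟫ := by
    have h1 : ε * (|⟪u, b - a⟫| + 1) = ⟪v, b - a⟫ := by rw [hε]; field_simp
    rw [inner_add_left, real_inner_smul_left]
    nlinarith [neg_abs_le ⟪u, b - a⟫]
  have hv' := Submodule.subset_span (R := ℝ)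
    (mem_tanCone_inter_closedBall hab hv (Or.inr hvpos))
  have hw' := Submodule.subset_span (R := ℝ)
    (mem_tanCone_inter_closedBall hab hw (Or.inr hwpos))
  have hdiff := Submodule.sub_mem _ hw' hv'
  rw [add_sub_cancel_left] at hdiff
  exact (Submodule.smul_mem_iff _ hεpos.ne').1 hdiff

theorem stmt13 {d : ℕ} (A : Set (Euc d)) (τ r : ℝ) (hτ : 0 < τ) (hτr : τ < r)
    (hr : ENNReal.ofReal r < reach A) (b : Euc d) (hb : b ∈ A) :
    (∀ a ∈ A ∩ Metric.closedBall b τ,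
        tanDim (A ∩ Metric.closedBall b τ) a = tanDim A a) ∧
      ∀ k, Tk (A ∩ Metric.closedBall b τ) k = Tk A k ∩ (A ∩ Metric.closedBall b τ) := by
  have hdim : ∀ a ∈ A ∩ Metric.closedBall b τ,
      tanDim (A ∩ Metric.closedBall b τ) a = tanDim A a := by
    rintro a ⟨ha, hab⟩
    rw [tanDim, tanDim, span_tanCone_inter_closedBall hτ hτr
      (fun x hx => mem_unp_of_infDist_lt ⟨b, hb⟩ hr hx) ha hb hab]
  refine ⟨hdim, fun k => Set.ext fun a => ⟨fun h => ?_, fun h => ?_⟩⟩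
  · exact ⟨⟨h.1.1, hdim a h.1 ▸ h.2⟩, h.1⟩
  · exact ⟨h.2, (hdim a h.2).trans h.1.2⟩
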